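/- arXiv:1609.07412 — 2 statements merged into one kernel-verified Lean document; each statement's English description precedes it below -/
import Mathlib

section
/- Let g(x) = 3/(4π√(x₃² − 2(x₁² + x₂²))) on the open cone interior {x ∈ ℝ³ : 2(x₁² + x₂²) < x₃²}. Then g satisfies the homogeneous wave-type equation P(∂)g = 0 pointwise on this open set, i.e. (2/3)∂²g/∂x₃² − (1/3)(∂²g/∂x₁² + ∂²g/∂x₂²) = 0 for every x with 2(x₁² + x₂²) < x₃². -/
/-- Points of `ℝ³`. -/
abbrev E3 : Type := EuclideanSpace ℝ (Fin 3)

/-- Second partial derivative in the `i`-th coordinate direction. -/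
noncomputable def pd2 (i : Fin 3) (f : E3 → ℝ) (x : E3) : ℝ :=
  fderiv ℝ (fun y => fderiv ℝ f y (EuclideanSpace.single i (1 : ℝ))) x
    (EuclideanSpace.single i (1 : ℝ))

/-- The fundamental solution kernel of the QSM wave-type operator. -/
noncomputable def gker (x : E3) : ℝ :=
  if 2 * ((x 0) ^ 2 + (x 1) ^ 2) < (x 2) ^ 2 then
    3 / (4 * Real.pi * Real.sqrt ((x 2) ^ 2 - 2 * ((x 0) ^ 2 + (x 1) ^ 2)))
  else 0

/-- The quadratic form `x₃² - 2 (x₁² + x₂²)`, positive exactly on the open cone. -/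
def coneForm (x : E3) : ℝ := (x 2) ^ 2 - 2 * ((x 0) ^ 2 + (x 1) ^ 2)

/-- The polar form of `coneForm`, linear in its second argument. -/
noncomputable def conePolar (v : E3) : E3 →L[ℝ] ℝ :=
  v 2 • EuclideanSpace.proj (𝕜 := ℝ) 2 -
    (2 : ℝ) • (v 0 • EuclideanSpace.proj (𝕜 := ℝ) 0 + v 1 • EuclideanSpace.proj (𝕜 := ℝ) 1)

theorem conePolar_apply (v x : E3) :
    conePolar v x = v 2 * x 2 - 2 * (v 0 * x 0 + v 1 * x 1) := by
  simp [conePolar, mul_add]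

theorem conePolar_comm (v x : E3) : conePolar v x = conePolar x v := by
  simp only [conePolar_apply]; ring

theorem hasFDerivAt_coneForm (x : E3) :
    HasFDerivAt coneForm ((2 : ℝ) • conePolar x) x := by
  have h (i : Fin 3) : HasFDerivAt (fun y : E3 => y i) (EuclideanSpace.proj (𝕜 := ℝ) i) x :=
    (EuclideanSpace.proj (𝕜 := ℝ) i).hasFDerivAt
  refine (((h 2).pow 2).sub ((((h 0).pow 2).add ((h 1).pow 2)).const_mul 2)).congr_fderiv ?_
  ext v
  simp [conePolar_apply]
  ring

theorem continuous_coneForm : Continuous coneForm :=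
  continuous_iff_continuousAt.2 fun x => (hasFDerivAt_coneForm x).continuousAt

theorem eventually_coneForm_pos {x : E3} (hx : 0 < coneForm x) :
    ∀ᶠ y in nhds x, 0 < coneForm y :=
  continuous_coneForm.continuousAt.eventually (lt_mem_nhds hx)

theorem gker_eq {x : E3} (hx : 0 < coneForm x) :
    gker x = 3 / (4 * Real.pi) * (Real.sqrt (coneForm x))⁻¹ := by
  have h : 2 * ((x 0) ^ 2 + (x 1) ^ 2) < (x 2) ^ 2 := sub_pos.1 hx
  rw [gker, if_pos h, coneForm]
  ring

theorem fderiv_gker_apply {x : E3} (hx : 0 < coneForm x) (v : E3) :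
    fderiv ℝ gker x v =
      -(3 / (4 * Real.pi)) * (conePolar v x * (Real.sqrt (coneForm x) ^ 3)⁻¹) := by
  have hs : Real.sqrt (coneForm x) ≠ 0 := (Real.sqrt_pos.2 hx).ne'
  have h := (((hasDerivAt_inv hs).comp_hasFDerivAt x
    ((hasFDerivAt_coneForm x).sqrt hx.ne')).const_mul (3 / (4 * Real.pi))).congr_of_eventuallyEq
      ((eventually_coneForm_pos hx).mono fun y hy => gker_eq hy)
  rw [h.fderiv, conePolar_comm v x]
  simp
  field_simp

theorem fderiv_fderiv_gker_apply {x : E3} (hx : 0 < coneForm x) (v : E3) :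
    fderiv ℝ (fun y => fderiv ℝ gker y v) x v =
      -(3 / (4 * Real.pi)) * ((conePolar v v * coneForm x - 3 * conePolar v x ^ 2) *
        (Real.sqrt (coneForm x) ^ 5)⁻¹) := by
  have hs : Real.sqrt (coneForm x) ≠ 0 := (Real.sqrt_pos.2 hx).ne'
  have h := (((conePolar v).hasFDerivAt.mul ((hasDerivAt_inv (pow_ne_zero 3 hs)).comp_hasFDerivAt x
    (((hasFDerivAt_coneForm x).sqrt hx.ne').pow 3))).const_mul
      (-(3 / (4 * Real.pi)))).congr_of_eventuallyEq
      ((eventually_coneForm_pos hx).mono fun y hy => fderiv_gker_apply hy v)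
  have hq : coneForm x = Real.sqrt (coneForm x) ^ 2 := (Real.sq_sqrt hx.le).symm
  rw [h.fderiv]
  simp [conePolar_comm x v]
  generalize Real.sqrt (coneForm x) = s at hs hq
  rw [hq]
  field_simp
  ring

/-- On the open cone interior, `g` satisfies the homogeneous wave-type equation
`(2/3)∂₃²g − (1/3)(∂₁²g + ∂₂²g) = 0` pointwise. -/
theorem stmt8 :
    ∀ x : E3, 2 * ((x 0) ^ 2 + (x 1) ^ 2) < (x 2) ^ 2 →
      (2 / 3 : ℝ) * pd2 2 gker x - (1 / 3 : ℝ) * (pd2 0 gker x + pd2 1 gker x) = 0 := by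
  intro x hx
  have hq : 0 < coneForm x := sub_pos.2 hx
  simp only [pd2, fderiv_fderiv_gker_apply hq]
  generalize Real.sqrt (coneForm x) = s
  simp [conePolar_apply, coneForm]
  ring
end

section
/- Let g : ℝ³ → ℝ be defined by g(x) = 3/(4π√(x₃² − 2(x₁² + x₂²))) when 2(x₁² + x₂²) < x₃² and g(x) = 0 otherwise, and let ψ be a smooth compactly supported function on ℝ³. Then for every x ∈ ℝ³ the integral χ(x) := −∫_{ℝ³} g(x − y) Δψ(y) dy converges absolutely, the function χ is smooth on ℝ³, and χ satisfies P(∂)χ = −Δψ pointwise, where P(∂) = (2/3)∂²/∂x₃² − (1/3)(∂²/∂x₁² + ∂²/∂x₂²) and Δ is the Laplacian on ℝ³. -/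
open MeasureTheory

/-- The QSM wave-type operator `P(∂) = (2/3)∂₃² − (1/3)(∂₁² + ∂₂²)`. -/
noncomputable def Pop (f : E3 → ℝ) (x : E3) : ℝ :=
  (2 / 3 : ℝ) * pd2 2 f x - (1 / 3 : ℝ) * (pd2 0 f x + pd2 1 f x)

/-- The Laplacian `Δ = ∂₁² + ∂₂² + ∂₃²` on `ℝ³`. -/
noncomputable def Lap (f : E3 → ℝ) (x : E3) : ℝ :=
  pd2 0 f x + pd2 1 f x + pd2 2 f x

open Set

/-- First partial derivative in the `i`-th coordinate direction. -/
noncomputable def pd (i : Fin 3) (f : E3 → ℝ) (x : E3) : ℝ :=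
  fderiv ℝ f x (EuclideanSpace.single i (1 : ℝ))

lemma pd2_eq (i : Fin 3) (f : E3 → ℝ) : pd2 i f = pd i (pd i f) := rfl

lemma ContDiff.pd {f : E3 → ℝ} (hf : ContDiff ℝ (⊤ : ℕ∞) f) (i : Fin 3) :
    ContDiff ℝ (⊤ : ℕ∞) (pd i f) :=
  (hf.fderiv_right (m := (⊤ : ℕ∞)) (by simp)).clm_apply contDiff_const

lemma HasCompactSupport.pd {f : E3 → ℝ} (hf : HasCompactSupport f) (i : Fin 3) :
    HasCompactSupport (pd i f) :=
  hf.fderiv_apply (𝕜 := ℝ) _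

lemma pd_comm {f : E3 → ℝ} (hf : ContDiff ℝ (⊤ : ℕ∞) f) (i j : Fin 3) (x : E3) :
    pd i (pd j f) x = pd j (pd i f) x := by
  have hd : DifferentiableAt ℝ (fderiv ℝ f) x :=
    ((hf.fderiv_right (m := (⊤ : ℕ∞)) (by simp)).differentiable (by simp)) x
  have key (k l : Fin 3) : pd k (pd l f) x =
      fderiv ℝ (fderiv ℝ f) x (EuclideanSpace.single k 1) (EuclideanSpace.single l 1) := by
    change fderiv ℝ (fun y => fderiv ℝ f y (EuclideanSpace.single l (1 : ℝ))) x _ = _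
    rw [fderiv_clm_apply hd (differentiableAt_const _)]
    simp
  rw [key, key]
  exact (hf.contDiffAt.isSymmSndFDerivAt (by
    rw [minSmoothness_of_isRCLikeNormedField]
    exact ENat.LEInfty.out)) _ _

lemma hasDerivAt_comp_curve {f : E3 → ℝ} (hf : ContDiff ℝ (⊤ : ℕ∞) f) {u v w : ℝ → ℝ}
    {u' v' w' s : ℝ} (hu : HasDerivAt u u' s) (hv : HasDerivAt v v' s) (hw : HasDerivAt w w' s) :
    HasDerivAt (fun s => f !₂[u s, v s, w s])
      (u' * pd 0 f !₂[u s, v s, w s] + v' * pd 1 f !₂[u s, v s, w s]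
        + w' * pd 2 f !₂[u s, v s, w s]) s := by
  have hγ : HasDerivAt (fun s => (!₂[u s, v s, w s] : E3)) !₂[u', v', w'] s := by
    have : HasDerivAt (fun s => ![u s, v s, w s]) ![u', v', w'] s := by
      rw [hasDerivAt_pi]
      intro i
      fin_cases i <;> simpa
    exact (PiLp.continuousLinearEquiv 2 ℝ (fun _ : Fin 3 => ℝ)).symm.hasFDerivAt.comp_hasDerivAt
      s this
  have h := ((hf.differentiable (by simp)) !₂[u s, v s, w s]).hasFDerivAt.comp_hasDerivAt s hγ
  refine h.congr_deriv ?_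
  have hdec : (!₂[u', v', w'] : E3) = u' • EuclideanSpace.single 0 1
      + v' • EuclideanSpace.single 1 1 + w' • EuclideanSpace.single 2 1 := by
    ext i
    fin_cases i <;> simp
  rw [hdec]
  simp [pd]

/-- The parameter box `(0, T) × (0, π/2) × (-π, π)`. -/
def box (T : ℝ) : Set (ℝ × ℝ × ℝ) :=
  Ioo 0 T ×ˢ (Ioo 0 (Real.pi / 2) ×ˢ Ioo (-Real.pi) Real.pi)

lemma integrableOn_box {A : ℝ × ℝ × ℝ → ℝ} (hA : Continuous A) (T : ℝ) :
    IntegrableOn A (box T) :=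
  (hA.continuousOn.integrableOn_compact
    (isCompact_Icc.prod (isCompact_Icc.prod isCompact_Icc))).mono_set
    (prod_mono Ioo_subset_Icc_self (prod_mono Ioo_subset_Icc_self Ioo_subset_Icc_self))

lemma volume_restrict_box (T : ℝ) :
    (volume : Measure (ℝ × ℝ × ℝ)).restrict (box T) = (volume.restrict (Ioo 0 T)).prod
      ((volume.restrict (Ioo 0 (Real.pi / 2))).prod
        (volume.restrict (Ioo (-Real.pi) Real.pi))) := by
  rw [box, Measure.volume_eq_prod, Measure.volume_eq_prod, Measure.prod_restrict,
    Measure.prod_restrict]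

lemma integral_Ioo_deriv {f f' : ℝ → ℝ} {a b : ℝ} (hab : a ≤ b) (hf' : Continuous f')
    (h : ∀ s, HasDerivAt f (f' s) s) : ∫ s in Ioo a b, f' s = f b - f a := by
  rw [← integral_Ioc_eq_integral_Ioo, ← intervalIntegral.integral_of_le hab]
  exact intervalIntegral.integral_eq_sub_of_hasDerivAt (fun s _ => h s)
    (hf'.intervalIntegrable _ _)

lemma integral_box_deriv_fst {A A' : ℝ × ℝ × ℝ → ℝ} (hA' : Continuous A') {T : ℝ} (hT : 0 ≤ T)
    (h : ∀ t α θ, HasDerivAt (fun t => A (t, α, θ)) (A' (t, α, θ)) t) :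
    ∫ p in box T, A' p = ∫ q, (A (T, q) - A (0, q))
      ∂((volume.restrict (Ioo 0 (Real.pi / 2))).prod
        (volume.restrict (Ioo (-Real.pi) Real.pi))) := by
  have hi := integrableOn_box hA' T
  rw [IntegrableOn, volume_restrict_box] at hi
  rw [volume_restrict_box, integral_prod_symm _ hi]
  refine integral_congr_ae (.of_forall fun q => ?_)
  exact integral_Ioo_deriv hT (by fun_prop) fun t => h t q.1 q.2

lemma integral_box_deriv_snd {A A' : ℝ × ℝ × ℝ → ℝ} (hA' : Continuous A') {T : ℝ}
    (h : ∀ t α θ, HasDerivAt (fun α => A (t, α, θ)) (A' (t, α, θ)) α)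
    (hA : ∀ t θ, A (t, Real.pi / 2, θ) = A (t, 0, θ)) :
    ∫ p in box T, A' p = 0 := by
  have hi := integrableOn_box hA' T
  rw [IntegrableOn, volume_restrict_box] at hi
  rw [volume_restrict_box, integral_prod _ hi]
  refine integral_eq_zero_of_ae ?_
  filter_upwards [hi.prod_right_ae] with t ht
  rw [integral_prod_symm _ ht]
  refine integral_eq_zero_of_ae (.of_forall fun θ => ?_)
  refine (integral_Ioo_deriv (by positivity) (by fun_prop) fun α => h t α θ).trans ?_
  simp [hA]

lemma integral_box_deriv_thd {A A' : ℝ × ℝ × ℝ → ℝ} (hA' : Continuous A') {T : ℝ}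
    (h : ∀ t α θ, HasDerivAt (fun θ => A (t, α, θ)) (A' (t, α, θ)) θ)
    (hA : ∀ t α, A (t, α, Real.pi) = A (t, α, -Real.pi)) :
    ∫ p in box T, A' p = 0 := by
  have hi := integrableOn_box hA' T
  rw [IntegrableOn, volume_restrict_box] at hi
  rw [volume_restrict_box, integral_prod _ hi]
  refine integral_eq_zero_of_ae ?_
  filter_upwards [hi.prod_right_ae] with t ht
  rw [integral_prod _ ht]
  refine integral_eq_zero_of_ae (.of_forall fun α => ?_)
  refine (integral_Ioo_deriv (by linarith [Real.pi_pos]) (by fun_prop) fun θ => h t α θ).trans ?_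
  simp [hA]

/-- Coordinates on the nappe of the cone `2(x₁² + x₂²) < x₃²` on which `x₃` has the sign `σ`. -/
noncomputable def conePoint (σ : ℝ) (p : ℝ × ℝ × ℝ) : E3 :=
  !₂[(√2)⁻¹ * p.1 * Real.sin p.2.1 * Real.cos p.2.2,
    (√2)⁻¹ * p.1 * Real.sin p.2.1 * Real.sin p.2.2, σ * p.1]

lemma continuous_conePoint (σ : ℝ) : Continuous (conePoint σ) := by
  refine (PiLp.continuous_toLp 2 _).comp (continuous_pi fun i => ?_)
  fin_cases i <;> simp <;> fun_prop

lemma integral_box_sin (T : ℝ) (hT : 0 ≤ T) {φ : E3 → ℝ} (hφ : ContDiff ℝ (⊤ : ℕ∞) φ)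
    {σ : ℝ} (hσ : σ ^ 2 = 1) (hvan : ∀ x : E3, x 2 = σ * T → φ x = 0 ∧ ∀ i, pd i φ x = 0) :
    ∫ p in box T, p.1 * Real.sin p.2.1 * Pop φ (conePoint σ p) = 4 * Real.pi / 3 * φ 0 := by
  set a : ℝ := (√2)⁻¹ with ha
  have ha2 : a ^ 2 = 1 / 2 := by simp [ha]
  have hΓ := continuous_conePoint σ
  have hc0 := hφ.continuous
  have hc1 (i) := (hφ.pd i).continuous
  have hc2 (i j) := ((hφ.pd i).pd j).continuous
  let A : ℝ × ℝ × ℝ → ℝ := fun p => Real.sin p.2.1 * (p.1 * σ * pd 2 φ (conePoint σ p)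
    - φ (conePoint σ p) - a * p.1 * Real.sin p.2.1 * (Real.cos p.2.2 * pd 0 φ (conePoint σ p)
      + Real.sin p.2.2 * pd 1 φ (conePoint σ p)))
  let A' : ℝ × ℝ × ℝ → ℝ := fun p => Real.sin p.2.1 * (p.1 * pd 2 (pd 2 φ) (conePoint σ p)
    - 2 * a * Real.sin p.2.1 * (Real.cos p.2.2 * pd 0 φ (conePoint σ p)
      + Real.sin p.2.2 * pd 1 φ (conePoint σ p))
    - a ^ 2 * p.1 * Real.sin p.2.1 ^ 2 * (Real.cos p.2.2 ^ 2 * pd 0 (pd 0 φ) (conePoint σ p)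
      + Real.cos p.2.2 * Real.sin p.2.2 * pd 0 (pd 1 φ) (conePoint σ p)
      + Real.cos p.2.2 * Real.sin p.2.2 * pd 1 (pd 0 φ) (conePoint σ p)
      + Real.sin p.2.2 ^ 2 * pd 1 (pd 1 φ) (conePoint σ p)))
  let B : ℝ × ℝ × ℝ → ℝ := fun p => -a * (Real.sin p.2.1 * Real.cos p.2.1) *
    (Real.cos p.2.2 * pd 0 φ (conePoint σ p) + Real.sin p.2.2 * pd 1 φ (conePoint σ p))
  let B' : ℝ × ℝ × ℝ → ℝ := fun p => -a * ((Real.cos p.2.1 ^ 2 - Real.sin p.2.1 ^ 2) *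
    (Real.cos p.2.2 * pd 0 φ (conePoint σ p) + Real.sin p.2.2 * pd 1 φ (conePoint σ p))
    + a * p.1 * Real.sin p.2.1 * Real.cos p.2.1 ^ 2 *
      (Real.cos p.2.2 ^ 2 * pd 0 (pd 0 φ) (conePoint σ p)
      + Real.cos p.2.2 * Real.sin p.2.2 * pd 0 (pd 1 φ) (conePoint σ p)
      + Real.cos p.2.2 * Real.sin p.2.2 * pd 1 (pd 0 φ) (conePoint σ p)
      + Real.sin p.2.2 ^ 2 * pd 1 (pd 1 φ) (conePoint σ p)))
  let C : ℝ × ℝ × ℝ → ℝ := fun p => -a *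
    (Real.cos p.2.2 * pd 1 φ (conePoint σ p) - Real.sin p.2.2 * pd 0 φ (conePoint σ p))
  let C' : ℝ × ℝ × ℝ → ℝ := fun p => -a *
    (a * p.1 * Real.sin p.2.1 * (Real.sin p.2.2 ^ 2 * pd 0 (pd 0 φ) (conePoint σ p)
      - Real.cos p.2.2 * Real.sin p.2.2 * pd 0 (pd 1 φ) (conePoint σ p)
      - Real.cos p.2.2 * Real.sin p.2.2 * pd 1 (pd 0 φ) (conePoint σ p)
      + Real.cos p.2.2 ^ 2 * pd 1 (pd 1 φ) (conePoint σ p))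
      - (Real.cos p.2.2 * pd 0 φ (conePoint σ p) + Real.sin p.2.2 * pd 1 φ (conePoint σ p)))
  have hA'c : Continuous A' := by fun_prop
  have hB'c : Continuous B' := by fun_prop
  have hC'c : Continuous C' := by fun_prop
  have hpt (p : ℝ × ℝ × ℝ) : p.1 * Real.sin p.2.1 * Pop φ (conePoint σ p)
      = 2 / 3 * (A' p + B' p + C' p) := by
    have h1 := Real.sin_sq_add_cos_sq p.2.1
    have h2 := Real.sin_sq_add_cos_sq p.2.2
    simp only [A', B', C', Pop, pd2_eq]
    linear_combination (2 / 3) * (a * (Real.cos p.2.2 * pd 0 φ (conePoint σ p)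
        + Real.sin p.2.2 * pd 1 φ (conePoint σ p)) + a ^ 2 * p.1 * Real.sin p.2.1 *
      (Real.cos p.2.2 ^ 2 * pd 0 (pd 0 φ) (conePoint σ p)
        + Real.cos p.2.2 * Real.sin p.2.2 * pd 0 (pd 1 φ) (conePoint σ p)
        + Real.cos p.2.2 * Real.sin p.2.2 * pd 1 (pd 0 φ) (conePoint σ p)
        + Real.sin p.2.2 ^ 2 * pd 1 (pd 1 φ) (conePoint σ p))) * h1
      + (2 / 3) * a ^ 2 * p.1 * Real.sin p.2.1 *
        (pd 0 (pd 0 φ) (conePoint σ p) + pd 1 (pd 1 φ) (conePoint σ p)) * h2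
      + (2 / 3) * p.1 * Real.sin p.2.1 *
        (pd 0 (pd 0 φ) (conePoint σ p) + pd 1 (pd 1 φ) (conePoint σ p)) * ha2
  have dt {f : E3 → ℝ} (hf : ContDiff ℝ (⊤ : ℕ∞) f) (t α θ : ℝ) :
      HasDerivAt (fun t => f (conePoint σ (t, α, θ)))
        (a * Real.sin α * Real.cos θ * pd 0 f (conePoint σ (t, α, θ))
          + a * Real.sin α * Real.sin θ * pd 1 f (conePoint σ (t, α, θ))
          + σ * pd 2 f (conePoint σ (t, α, θ))) t := by
    have h (c : ℝ) : HasDerivAt (fun t => a * t * Real.sin α * c) (a * Real.sin α * c) t := by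
      simpa using (((hasDerivAt_id t).const_mul a).mul_const (Real.sin α)).mul_const c
    have hw : HasDerivAt (fun t => σ * t) σ t := by simpa using (hasDerivAt_id t).const_mul σ
    have := hasDerivAt_comp_curve hf (h (Real.cos θ)) (h (Real.sin θ)) hw
    exact this
  have dα {f : E3 → ℝ} (hf : ContDiff ℝ (⊤ : ℕ∞) f) (t α θ : ℝ) :
      HasDerivAt (fun α => f (conePoint σ (t, α, θ)))
        (a * t * Real.cos α * Real.cos θ * pd 0 f (conePoint σ (t, α, θ))
          + a * t * Real.cos α * Real.sin θ * pd 1 f (conePoint σ (t, α, θ))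
          + 0 * pd 2 f (conePoint σ (t, α, θ))) α := by
    have h (c : ℝ) : HasDerivAt (fun α => a * t * Real.sin α * c) (a * t * Real.cos α * c) α :=
      ((Real.hasDerivAt_sin α).const_mul (a * t)).mul_const c
    have := hasDerivAt_comp_curve hf (h (Real.cos θ)) (h (Real.sin θ))
      (hasDerivAt_const α (σ * t))
    exact this
  have dθ {f : E3 → ℝ} (hf : ContDiff ℝ (⊤ : ℕ∞) f) (t α θ : ℝ) :
      HasDerivAt (fun θ => f (conePoint σ (t, α, θ)))
        (a * t * Real.sin α * -Real.sin θ * pd 0 f (conePoint σ (t, α, θ))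
          + a * t * Real.sin α * Real.cos θ * pd 1 f (conePoint σ (t, α, θ))
          + 0 * pd 2 f (conePoint σ (t, α, θ))) θ := by
    have := hasDerivAt_comp_curve hf ((Real.hasDerivAt_cos θ).const_mul (a * t * Real.sin α))
      ((Real.hasDerivAt_sin θ).const_mul (a * t * Real.sin α)) (hasDerivAt_const θ (σ * t))
    exact this
  have hA : ∫ p in box T, A' p = 2 * Real.pi * φ 0 := by
    rw [integral_box_deriv_fst (A := A) hA'c hT]
    · have hz (q : ℝ × ℝ) : A (T, q) - A (0, q) = Real.sin q.1 * φ 0 := by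
        have hT' := hvan (conePoint σ (T, q)) (by simp [conePoint])
        have h0 : conePoint σ (0, q) = 0 := by
          ext i
          fin_cases i <;> simp [conePoint]
        simp [A, h0, hT'.1, hT'.2]
      simp_rw [hz]
      rw [integral_prod_mul (μ := volume.restrict (Ioo 0 (Real.pi / 2))) Real.sin
        (fun _ => φ 0), integral_Ioo_deriv (f := fun s => -Real.cos s) (by positivity)
        Real.continuous_sin (fun s => (Real.hasDerivAt_cos s).neg.congr_deriv (neg_neg _))]
      have : Real.pi + Real.pi = 2 * Real.pi := by ring
      simp [this, Real.pi_pos.le]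
    · intro t α θ
      have h := ((((hasDerivAt_id t).mul_const σ).mul (dt (hφ.pd 2) t α θ)).sub (dt hφ t α θ)).sub
        ((((hasDerivAt_id t).const_mul a).mul_const (Real.sin α)).mul
          (((dt (hφ.pd 0) t α θ).const_mul (Real.cos θ)).add
            ((dt (hφ.pd 1) t α θ).const_mul (Real.sin θ)))) |>.const_mul (Real.sin α)
      refine h.congr_deriv ?_
      simp only [A', id, Pi.add_apply, pd_comm hφ 2 0, pd_comm hφ 2 1]
      linear_combination Real.sin α * t * pd 2 (pd 2 φ) (conePoint σ (t, α, θ)) * hσ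
  have hB : ∫ p in box T, B' p = 0 := by
    refine integral_box_deriv_snd (A := B) hB'c ?_ (by simp [B])
    intro t α θ
    have h := (((Real.hasDerivAt_sin α).mul (Real.hasDerivAt_cos α)).const_mul (-a)).mul
      (((dα (hφ.pd 0) t α θ).const_mul (Real.cos θ)).add
        ((dα (hφ.pd 1) t α θ).const_mul (Real.sin θ)))
    refine h.congr_deriv ?_
    simp only [B', Pi.mul_apply, Pi.add_apply]
    ring
  have hC : ∫ p in box T, C' p = 0 := by
    refine integral_box_deriv_thd (A := C) hC'c ?_ (by simp [C, conePoint])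
    intro t α θ
    have h := (((Real.hasDerivAt_cos θ).mul (dθ (hφ.pd 1) t α θ)).sub
      ((Real.hasDerivAt_sin θ).mul (dθ (hφ.pd 0) t α θ))).const_mul (-a)
    refine h.congr_deriv ?_
    simp only [C']
    ring
  have iA := integrableOn_box hA'c T
  have iB := integrableOn_box hB'c T
  have iC := integrableOn_box hC'c T
  simp_rw [hpt]
  rw [integral_const_mul, integral_add (f := fun p => A' p + B' p) (iA.add iB) iC,
    integral_add iA iB, hA, hB, hC]
  ring
lemma lintegral_E3 {F : E3 → ENNReal} (hF : Measurable F) :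
    ∫⁻ x, F x = ∫⁻ t : ℝ, ∫⁻ q : ℝ × ℝ, F !₂[q.1, q.2, t] := by
  have h1 := (volume_preserving_finTwoArrow ℝ).symm
  have h2 : MeasurePreserving (Prod.map (id : ℝ → ℝ) (MeasurableEquiv.finTwoArrow (α := ℝ)).symm)
      volume volume := (MeasurePreserving.id volume).prod h1
  have h3 := (volume_preserving_piFinSuccAbove (fun _ : Fin 3 => ℝ) 2).symm
  have h4 := (PiLp.volume_preserving_toLp (Fin 3)).comp (h3.comp h2)
  rw [← h4.lintegral_comp hF, Measure.volume_eq_prod, lintegral_prod]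
  · refine lintegral_congr fun t => lintegral_congr fun q => ?_
    congr 1
    ext i
    fin_cases i <;> rfl
  · exact (hF.comp h4.measurable).aemeasurable

lemma lintegral_polar {G : ℝ × ℝ → ENNReal} (hG : Measurable G) :
    ∫⁻ q, G q = ∫⁻ r in Ioi (0 : ℝ), ∫⁻ θ in Ioo (-Real.pi) Real.pi,
      ENNReal.ofReal r * G (r * Real.cos θ, r * Real.sin θ) := by
  rw [← lintegral_comp_polarCoord_symm, polarCoord_target, Measure.volume_eq_prod,
    setLIntegral_prod]
  · simp
  · simp only [polarCoord_symm_apply, smul_eq_mul]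
    exact Measurable.aemeasurable (by fun_prop)

lemma image_sin_Ioo {b : ℝ} (hb : 0 < b) :
    (fun α => b * Real.sin α) '' Ioo 0 (Real.pi / 2) = Ioo 0 b := by
  ext r
  constructor
  · rintro ⟨α, ⟨h0, h1⟩, rfl⟩
    have hs := Real.sin_pos_of_pos_of_lt_pi h0 (by linarith [Real.pi_pos])
    have hc : Real.sin α < 1 := by
      have := Real.sin_lt_sin_of_lt_of_le_pi_div_two (by linarith) le_rfl h1
      rwa [Real.sin_pi_div_two] at this
    exact ⟨by positivity, by simpa using mul_lt_mul_of_pos_left hc hb⟩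
  · rintro ⟨h0, h1⟩
    have hr1 : r / b < 1 := (div_lt_one hb).2 h1
    have hr0 : 0 < r / b := by positivity
    refine ⟨Real.arcsin (r / b), ⟨Real.arcsin_pos.2 hr0, Real.arcsin_lt_pi_div_two.2 hr1⟩, ?_⟩
    simp only
    rw [Real.sin_arcsin (by linarith) hr1.le]
    field_simp

lemma gker_nonneg (x : E3) : 0 ≤ gker x := by
  unfold gker
  split_ifs <;> positivity

lemma measurable_gker : Measurable gker := by
  unfold gker
  refine Measurable.ite (measurableSet_lt ?_ ?_) ?_ ?_ <;> fun_prop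

lemma gker_conePoint {σ t α θ : ℝ} (hσ : σ ^ 2 = 1) (ht : 0 < t) (hα : 0 < Real.cos α) :
    gker (conePoint σ (t, α, θ)) = 3 / (4 * Real.pi * (t * Real.cos α)) := by
  have ha2 : ((√2)⁻¹ : ℝ) ^ 2 = 1 / 2 := by simp
  have h1 := Real.sin_sq_add_cos_sq α
  have h2 := Real.sin_sq_add_cos_sq θ
  have key : (conePoint σ (t, α, θ) 2) ^ 2 - 2 * ((conePoint σ (t, α, θ) 0) ^ 2
      + (conePoint σ (t, α, θ) 1) ^ 2) = (t * Real.cos α) ^ 2 := by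
    simp only [conePoint, PiLp.toLp_apply, Matrix.cons_val]
    generalize (√2 : ℝ)⁻¹ = a at *
    linear_combination t ^ 2 * hσ - 2 * t ^ 2 * Real.sin α ^ 2 * a ^ 2 * h2
      - 2 * t ^ 2 * Real.sin α ^ 2 * ha2 - t ^ 2 * h1
  rw [gker, if_pos (by rw [← sub_pos, key]; positivity), key, Real.sqrt_sq (by positivity)]

lemma gker_polar_eq_zero {σ t r θ : ℝ} (hσ : σ ^ 2 = 1) (ht : 0 < t) (hr : (√2)⁻¹ * t ≤ r) :
    gker !₂[r * Real.cos θ, r * Real.sin θ, σ * t] = 0 := by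
  have h2 := Real.sin_sq_add_cos_sq θ
  have hr2 : t ^ 2 ≤ 2 * r ^ 2 := by
    have := pow_le_pow_left₀ (by positivity) hr 2
    rw [mul_pow, inv_pow, Real.sq_sqrt (by norm_num)] at this
    linarith
  rw [gker, if_neg]
  simp only [Matrix.cons_val, not_lt]
  calc (σ * t) ^ 2 = t ^ 2 := by linear_combination t ^ 2 * hσ
    _ ≤ 2 * r ^ 2 := hr2
    _ = _ := by linear_combination (-2 * r ^ 2) * h2

lemma lintegral_gker_slice {F : E3 → ENNReal} (hF : Measurable F) {σ t : ℝ} (hσ : σ ^ 2 = 1)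
    (ht : 0 < t) :
    ∫⁻ q : ℝ × ℝ, ENNReal.ofReal (gker !₂[q.1, q.2, σ * t]) * F !₂[q.1, q.2, σ * t]
      = ∫⁻ α in Ioo 0 (Real.pi / 2), ∫⁻ θ in Ioo (-Real.pi) Real.pi,
        ENNReal.ofReal (3 / (8 * Real.pi) * t * Real.sin α) * F (conePoint σ (t, α, θ)) := by
  have hb : 0 < (√2)⁻¹ * t := by positivity
  have hm : Measurable fun q : ℝ × ℝ => (!₂[q.1, q.2, σ * t] : E3) := by
    refine (PiLp.continuous_toLp 2 _).measurable.comp (measurable_pi_lambda _ fun i => ?_)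
    fin_cases i <;> simp <;> fun_prop
  rw [lintegral_polar (G := fun q => ENNReal.ofReal (gker !₂[q.1, q.2, σ * t]) *
      F !₂[q.1, q.2, σ * t]) ((measurable_gker.comp hm).ennreal_ofReal.mul (hF.comp hm)),
    ← Ioo_union_Ici_eq_Ioi hb, lintegral_union measurableSet_Ici
      (Set.disjoint_left.2 fun x hx hx' => absurd hx.2 (not_lt.2 hx')),
    ← image_sin_Ioo hb, lintegral_image_eq_lintegral_abs_deriv_mul measurableSet_Ioo
      (f' := fun α => (√2)⁻¹ * t * Real.cos α)
      (fun α _ => ((Real.hasDerivAt_sin α).const_mul _).hasDerivWithinAt)]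
  · have hzero : ∫⁻ r in Ici ((√2)⁻¹ * t), ∫⁻ θ in Ioo (-Real.pi) Real.pi, ENNReal.ofReal r *
        (ENNReal.ofReal (gker !₂[r * Real.cos θ, r * Real.sin θ, σ * t]) *
          F !₂[r * Real.cos θ, r * Real.sin θ, σ * t]) = 0 := by
      refine (setLIntegral_congr_fun measurableSet_Ici fun r hr => ?_).trans lintegral_zero
      simp [gker_polar_eq_zero hσ ht hr]
    rw [hzero, add_zero]
    refine setLIntegral_congr_fun measurableSet_Ioo fun α hα => ?_
    have hs := Real.sin_pos_of_pos_of_lt_pi hα.1 (by linarith [Real.pi_pos, hα.2])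
    have hc := Real.cos_pos_of_mem_Ioo (x := α) ⟨by linarith [Real.pi_pos, hα.1], hα.2⟩
    simp only
    rw [← lintegral_const_mul' _ _ ENNReal.ofReal_ne_top]
    refine lintegral_congr fun θ => ?_
    have hg := gker_conePoint (θ := θ) hσ ht hc
    rw [conePoint] at hg
    simp only at hg
    rw [conePoint, hg, ← mul_assoc, ← mul_assoc, ← ENNReal.ofReal_mul (by positivity),
      ← ENNReal.ofReal_mul (by positivity), abs_of_pos (by positivity)]
    congr 2
    have ha2 : ((√2)⁻¹ : ℝ) ^ 2 = 1 / 2 := by simp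
    generalize (√2 : ℝ)⁻¹ = a at *
    have := Real.pi_pos
    field_simp
    linear_combination 8 * ha2
  · intro x hx y hy hxy
    exact Real.injOn_sin ⟨by linarith [Real.pi_pos, hx.1], hx.2.le⟩
      ⟨by linarith [Real.pi_pos, hy.1], hy.2.le⟩ (mul_left_cancel₀ hb.ne' hxy)

lemma lintegral_eq_add_comp_neg (K : ℝ → ENNReal) :
    ∫⁻ t, K t = (∫⁻ t in Ioi (0 : ℝ), K t) + ∫⁻ t in Ioi (0 : ℝ), K (-t) := by
  have h := (Measure.measurePreserving_neg (volume : Measure ℝ)).setLIntegral_comp_preimage_emb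
    (MeasurableEquiv.neg ℝ).measurableEmbedding K (Iio 0)
  have hpre : (Neg.neg : ℝ → ℝ) ⁻¹' Iio 0 = Ioi 0 := by
    ext; simp
  rw [hpre] at h
  rw [h, ← lintegral_add_compl K measurableSet_Ioi (A := Ioi (0 : ℝ)), compl_Ioi,
    setLIntegral_congr Iio_ae_eq_Iic]

/-- Lebesgue measure on the unbounded parameter domain `(0, ∞) × (0, π/2) × (-π, π)`. -/
noncomputable def coneParam : Measure (ℝ × ℝ × ℝ) :=
  (volume.restrict (Ioi 0)).prod
    ((volume.restrict (Ioo 0 (Real.pi / 2))).prod (volume.restrict (Ioo (-Real.pi) Real.pi)))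

/-- The density of the kernel in the cone coordinates. -/
noncomputable def coneWeight (p : ℝ × ℝ × ℝ) : ℝ := 3 / (8 * Real.pi) * p.1 * Real.sin p.2.1

lemma continuous_coneWeight : Continuous coneWeight := by
  unfold coneWeight; fun_prop

lemma lintegral_coneParam {F : ℝ × ℝ × ℝ → ENNReal} (hF : Measurable F) :
    ∫⁻ p, F p ∂coneParam = ∫⁻ t in Ioi 0, ∫⁻ α in Ioo 0 (Real.pi / 2),
      ∫⁻ θ in Ioo (-Real.pi) Real.pi, F (t, α, θ) := by
  rw [coneParam, lintegral_prod _ hF.aemeasurable]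
  refine lintegral_congr fun t => ?_
  rw [lintegral_prod _ (by fun_prop)]

/-- The measure with density `gker`, as the image of the parameter domain under cone
coordinates. -/
lemma withDensity_gker :
    (volume : Measure E3).withDensity (fun x => ENNReal.ofReal (gker x)) =
      (coneParam.withDensity fun p => ENNReal.ofReal (coneWeight p)).map (conePoint 1) +
      (coneParam.withDensity fun p => ENNReal.ofReal (coneWeight p)).map (conePoint (-1)) := by
  have hw : Measurable fun p => ENNReal.ofReal (coneWeight p) :=
    continuous_coneWeight.measurable.ennreal_ofReal
  have hΓ (σ : ℝ) : Measurable (conePoint σ) := (continuous_conePoint σ).measurable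
  refine Measure.ext_of_lintegral _ fun F hF => ?_
  have hg := measurable_gker.ennreal_ofReal
  have hm (σ : ℝ) : Measurable
      ((fun p => ENNReal.ofReal (coneWeight p)) * fun p => F (conePoint σ p)) :=
    hw.mul (hF.comp (hΓ σ))
  rw [lintegral_withDensity_eq_lintegral_mul _ hg hF, lintegral_add_measure,
    lintegral_map hF (hΓ 1), lintegral_map hF (hΓ (-1)),
    lintegral_withDensity_eq_lintegral_mul _ hw (g := fun p => F (conePoint 1 p)) (hF.comp (hΓ 1)),
    lintegral_withDensity_eq_lintegral_mul _ hw (g := fun p => F (conePoint (-1) p))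
      (hF.comp (hΓ (-1))),
    lintegral_coneParam (hm 1), lintegral_coneParam (hm (-1)),
    lintegral_E3 (hg.mul hF), lintegral_eq_add_comp_neg]
  congr 1 <;> refine setLIntegral_congr_fun measurableSet_Ioi fun t ht => ?_
  · simpa [coneWeight] using lintegral_gker_slice hF (σ := 1) (by norm_num) ht
  · simpa [coneWeight] using lintegral_gker_slice hF (σ := -1) (by norm_num) ht

lemma coneParam_eq : coneParam = (volume : Measure (ℝ × ℝ × ℝ)).restrict
    (Ioi 0 ×ˢ (Ioo 0 (Real.pi / 2) ×ˢ Ioo (-Real.pi) Real.pi)) := by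
  rw [coneParam, Measure.volume_eq_prod, Measure.volume_eq_prod, Measure.prod_restrict,
    Measure.prod_restrict]

lemma coneParam_restrict (T : ℝ) :
    coneParam.restrict {p | p.1 < T} = volume.restrict (box T) := by
  rw [coneParam_eq, Measure.restrict_restrict (measurableSet_lt (by fun_prop) (by fun_prop))]
  congr 1
  ext p
  simp only [box, mem_inter_iff, mem_ofPred_eq, mem_prod, mem_Ioi, mem_Ioo]
  tauto

lemma exists_height_bound {K : Set E3} (hK : IsCompact K) : ∃ T : ℝ, 0 < T ∧ ∀ x ∈ K, |x 2| < T := by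
  obtain ⟨C, hC⟩ := hK.exists_bound_of_continuousOn (f := fun x : E3 => x 2) (by fun_prop)
  refine ⟨max C 0 + 1, by positivity, fun x hx => ?_⟩
  have := hC x hx
  rw [Real.norm_eq_abs] at this
  linarith [le_max_left C 0]

lemma locallyIntegrable_gker : LocallyIntegrable gker := by
  refine locallyIntegrable_iff.2 fun K hK => ⟨measurable_gker.aestronglyMeasurable, ?_⟩
  obtain ⟨T, -, hT⟩ := exists_height_bound hK
  have hnorm (x : E3) : ‖gker x‖ₑ = ENNReal.ofReal (gker x) := by
    rw [Real.enorm_eq_ofReal (gker_nonneg x)]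
  have hfin (σ : ℝ) (hσ : |σ| = 1) :
      (coneParam.withDensity fun p => ENNReal.ofReal (coneWeight p)).map (conePoint σ) K < ⊤ := by
    rw [Measure.map_apply (continuous_conePoint σ).measurable hK.measurableSet]
    have hsub : conePoint σ ⁻¹' K ⊆ {p | p.1 < T} := by
      intro p hp
      have := hT _ hp
      simp only [conePoint, Matrix.cons_val, abs_mul, hσ, one_mul] at this
      exact (le_abs_self _).trans_lt this
    refine (measure_mono hsub).trans_lt ?_
    rw [withDensity_apply _ (measurableSet_lt (by fun_prop) (by fun_prop)), coneParam_restrict]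
    exact (integrableOn_box continuous_coneWeight T).lintegral_lt_top
  rw [HasFiniteIntegral]
  simp_rw [hnorm]
  rw [← withDensity_apply _ hK.measurableSet, withDensity_gker, Measure.add_apply]
  exact ENNReal.add_lt_top.2 ⟨hfin 1 (by simp), hfin (-1) (by simp)⟩

lemma integral_gker_mul {f : E3 → ℝ} (hf : Continuous f) (hc : HasCompactSupport f) {T : ℝ}
    (hT : ∀ x : E3, T ≤ |x 2| → f x = 0) :
    ∫ x, gker x * f x = (∫ p in box T, coneWeight p * f (conePoint 1 p)) +
      ∫ p in box T, coneWeight p * f (conePoint (-1) p) := by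
  have hg := measurable_gker.ennreal_ofReal
  have hw : Measurable fun p => ENNReal.ofReal (coneWeight p) :=
    continuous_coneWeight.measurable.ennreal_ofReal
  have hi : Integrable f ((volume : Measure E3).withDensity fun x => ENNReal.ofReal (gker x)) := by
    rw [integrable_withDensity_iff_integrable_smul' hg (by simp)]
    simp_rw [ENNReal.toReal_ofReal (gker_nonneg _)]
    exact locallyIntegrable_gker.integrable_smul_right_of_hasCompactSupport hf hc
  have h1 : ∫ x, gker x * f x =
      ∫ x, f x ∂(volume : Measure E3).withDensity fun x => ENNReal.ofReal (gker x) := by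
    rw [integral_withDensity_eq_integral_toReal_smul hg (by simp)]
    simp_rw [ENNReal.toReal_ofReal (gker_nonneg _), smul_eq_mul]
  have hσ (σ : ℝ) (hσ : |σ| = 1) :
      ∫ x, f x ∂(coneParam.withDensity fun p => ENNReal.ofReal (coneWeight p)).map (conePoint σ)
        = ∫ p in box T, coneWeight p * f (conePoint σ p) := by
    rw [integral_map (continuous_conePoint σ).measurable.aemeasurable
      hf.aestronglyMeasurable, integral_withDensity_eq_integral_toReal_smul hw (by simp),
      ← coneParam_restrict, setIntegral_eq_integral_of_forall_compl_eq_zero]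
    · rw [coneParam_eq]
      refine setIntegral_congr_fun (by measurability) fun p hp => ?_
      have hs : 0 ≤ Real.sin p.2.1 := Real.sin_nonneg_of_nonneg_of_le_pi hp.2.1.1.le
        (by linarith [Real.pi_pos, hp.2.1.2])
      have hp1 : 0 < p.1 := hp.1
      simp only [smul_eq_mul]
      rw [ENNReal.toReal_ofReal (by unfold coneWeight; positivity)]
    · intro p hp
      rw [hT, mul_zero]
      simp only [mem_ofPred_eq, not_lt] at hp
      simp only [conePoint, Matrix.cons_val, abs_mul, hσ, one_mul]
      exact hp.trans (le_abs_self _)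
  rw [withDensity_gker] at hi h1
  rw [h1, integral_add_measure hi.left_of_add_measure hi.right_of_add_measure, hσ 1 (by simp),
    hσ (-1) (by simp)]

lemma continuous_Pop {φ : E3 → ℝ} (hφ : ContDiff ℝ (⊤ : ℕ∞) φ) : Continuous (Pop φ) := by
  have h (i) := ((hφ.pd i).pd i).continuous
  unfold Pop
  simp only [pd2_eq]
  fun_prop

/-- `gker` is a fundamental solution of `Pop`. -/
lemma integral_gker_mul_Pop {φ : E3 → ℝ} (hφ : ContDiff ℝ (⊤ : ℕ∞) φ)
    (hc : HasCompactSupport φ) : ∫ x, gker x * Pop φ x = φ 0 := by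
  obtain ⟨T, hT0, hT⟩ := exists_height_bound hc.isCompact
  have hout (x : E3) (hx : T ≤ |x 2|) : x ∉ tsupport φ := fun h => (hT x h).not_ge hx
  have hpd {f : E3 → ℝ} {x : E3} (hx : x ∉ tsupport f) (i : Fin 3) : pd i f x = 0 := by
    simp [pd, fderiv_of_notMem_tsupport ℝ hx]
  have hts (f : E3 → ℝ) (i : Fin 3) : tsupport (pd i f) ⊆ tsupport f :=
    closure_minimal (fun x hx => by_contra fun h => hx (hpd h i)) (isClosed_tsupport f)
  have hPop (x : E3) (hx : x ∉ tsupport φ) : Pop φ x = 0 := by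
    have (i : Fin 3) : pd2 i φ x = 0 := hpd (fun h => hx (hts φ i h)) i
    simp [Pop, this]
  have hPc : HasCompactSupport (Pop φ) := .intro hc.isCompact hPop
  have hside (σ : ℝ) (hσ : σ = 1 ∨ σ = -1) :
      ∫ p in box T, coneWeight p * Pop φ (conePoint σ p) = φ 0 / 2 := by
    have h := integral_box_sin T hT0.le hφ (σ := σ) (by rcases hσ with rfl | rfl <;> norm_num) (by
      intro x hx
      have := hout x (by rcases hσ with rfl | rfl <;> simp [hx, le_abs_self])
      exact ⟨image_eq_zero_of_notMem_tsupport this, hpd this⟩)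
    calc _ = ∫ p in box T, 3 / (8 * Real.pi) *
          (p.1 * Real.sin p.2.1 * Pop φ (conePoint σ p)) := by
          congr 1; ext p; rw [coneWeight]; ring
      _ = _ := by
          rw [integral_const_mul, h]
          field_simp
          ring
  rw [integral_gker_mul (continuous_Pop hφ) hPc (fun x hx => hPop x (hout x hx)),
    hside 1 (.inl rfl), hside (-1) (.inr rfl)]
  ring

/-- Convolution of `gker` with a test function. -/
noncomputable def gconv (f : E3 → ℝ) : E3 → ℝ :=
  convolution gker f (ContinuousLinearMap.mul ℝ ℝ) volume

lemma gconv_apply (f : E3 → ℝ) (x : E3) : gconv f x = ∫ y, gker y * f (x - y) := rfl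

lemma contDiff_gconv {f : E3 → ℝ} (hf : ContDiff ℝ (⊤ : ℕ∞) f) (hc : HasCompactSupport f) :
    ContDiff ℝ (⊤ : ℕ∞) (gconv f) :=
  hc.contDiff_convolution_right _ locallyIntegrable_gker hf

lemma pd_gconv {f : E3 → ℝ} (hf : ContDiff ℝ (⊤ : ℕ∞) f) (hc : HasCompactSupport f) (i : Fin 3) :
    pd i (gconv f) = gconv (pd i f) := by
  ext x
  rw [pd, gconv, (hc.hasFDerivAt_convolution_right _ locallyIntegrable_gker
    (hf.of_le (by simp)) x).fderiv, convolution_precompR_apply _ locallyIntegrable_gker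
    (hc.fderiv ℝ) (hf.continuous_fderiv (by simp))]
  rfl

lemma pd_neg (f : E3 → ℝ) (i : Fin 3) : pd i (fun x => -f x) = fun x => -pd i f x := by
  ext x
  simp [pd]

lemma pd_comp_sub_left {f : E3 → ℝ} (hf : ContDiff ℝ (⊤ : ℕ∞) f) (i : Fin 3) (a : E3) :
    pd i (fun x => f (a - x)) = fun x => -pd i f (a - x) := by
  ext x
  have h := ((hf.differentiable (by simp)) (a - x)).hasFDerivAt.comp x
    ((hasFDerivAt_id x).const_sub a)
  rw [pd]
  refine (congrArg (fun L : E3 →L[ℝ] ℝ => L (EuclideanSpace.single i 1)) h.fderiv).trans ?_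
  simp [pd]

lemma ContDiff.lap {ψ : E3 → ℝ} (hψ : ContDiff ℝ (⊤ : ℕ∞) ψ) : ContDiff ℝ (⊤ : ℕ∞) (Lap ψ) :=
  ((((hψ.pd 0).pd 0).add ((hψ.pd 1).pd 1)).add ((hψ.pd 2).pd 2))

lemma HasCompactSupport.lap {ψ : E3 → ℝ} (hψ : HasCompactSupport ψ) :
    HasCompactSupport (Lap ψ) :=
  (((hψ.pd 0).pd 0).add ((hψ.pd 1).pd 1)).add ((hψ.pd 2).pd 2)

lemma Pop_gconv {f : E3 → ℝ} (hf : ContDiff ℝ (⊤ : ℕ∞) f) (hc : HasCompactSupport f) (x : E3) :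
    Pop (gconv f) x = f x := by
  have hpd2 (i : Fin 3) : pd2 i (gconv f) = gconv (pd2 i f) := by
    simp only [pd2_eq]
    rw [pd_gconv hf hc, pd_gconv (hf.pd i) (hc.pd i)]
  have hi (i : Fin 3) : Integrable fun y => gker y * pd2 i f (x - y) :=
    ((hc.pd i).pd i).convolutionExists_right (ContinuousLinearMap.mul ℝ ℝ) locallyIntegrable_gker
      ((hf.pd i).pd i).continuous x
  have hi01 : Integrable fun y => gker y * pd2 0 f (x - y) + gker y * pd2 1 f (x - y) :=
    (hi 0).add (hi 1)
  have hrefl (y : E3) : Pop (fun z => f (x - z)) y = Pop f (x - y) := by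
    simp only [Pop, pd2_eq, pd_comp_sub_left hf, pd_comp_sub_left (hf.pd _), pd_neg, neg_neg]
  have h := integral_gker_mul_Pop (φ := fun z => f (x - z))
    (hf.comp (contDiff_const.sub contDiff_id)) (hc.comp_homeomorph (Homeomorph.subLeft x))
  simp only [hrefl, sub_zero] at h
  rw [← h, Pop, hpd2, hpd2, hpd2, gconv_apply, gconv_apply, gconv_apply,
    ← integral_add (hi 0) (hi 1), ← integral_const_mul, ← integral_const_mul,
    ← integral_sub ((hi 2).const_mul _) (hi01.const_mul _)]
  congr 1
  ext y
  simp only [Pop]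
  ring

/-- For smooth compactly supported `ψ`, the convolution `χ = −g ∗ (Δψ)` is given by an
absolutely convergent integral, is smooth, and solves `P(∂)χ = −Δψ` pointwise. -/
theorem stmt10 (ψ : E3 → ℝ) (hψ : ContDiff ℝ (⊤ : ℕ∞) ψ) (hsupp : HasCompactSupport ψ)
    (χ : E3 → ℝ) (hχ : ∀ x : E3, χ x = -∫ y : E3, gker (x - y) * Lap ψ y) :
    (∀ x : E3, Integrable (fun y : E3 => gker (x - y) * Lap ψ y) volume) ∧
      ContDiff ℝ (⊤ : ℕ∞) χ ∧
      ∀ x : E3, Pop χ x = -(Lap ψ x) := by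
  have hf := hψ.lap
  have hc := hsupp.lap
  have hχ' : χ = fun x => -gconv (Lap ψ) x := by
    ext x
    rw [hχ, gconv_apply, ← integral_sub_left_eq_self _ volume x]
    simp
  refine ⟨fun x => ?_, hχ' ▸ (contDiff_gconv hf hc).neg, fun x => ?_⟩
  · have := (hc.convolutionExists_right (ContinuousLinearMap.mul ℝ ℝ) locallyIntegrable_gker
      hf.continuous x).integrable.comp_sub_left x
    simpa using this
  · rw [← Pop_gconv hf hc x, hχ', Pop, Pop]
    simp only [pd2_eq, pd_neg]
    ring
end
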